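/- There is an absolute constant C such that for every real x ≥ 2, ∑ q/φ(q)² ≤ C·log x, where the sum is over odd squarefree positive integers q for which the multiplicative order of 2 modulo q is at most x. -/

import Mathlib

/-- The upper bound in Mertens' first theorem. -/
theorem sum_primesLE_log_div_le {N : ℕ} (hN : 0 < N) :
    ∑ p ∈ N.primesLE, Real.log p / p ≤ Real.log N + Real.log 4 := by
  have hN' : (0 : ℝ) < N := by exact_mod_cast hN
  have log_ge : ∀ n ∈ Finset.Ioc 0 N,
      ∑ p ∈ N.primesLE with p ∣ n, Real.log p ≤ Real.log N := by
    intro n hn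
    rw [Finset.mem_Ioc] at hn
    have hsub : ∏ p ∈ N.primesLE with p ∣ n, p ≤ N := by
      refine le_trans (Nat.le_of_dvd hn.1 ?_) hn.2
      refine (Finset.prod_dvd_prod_of_subset _ n.primeFactors _ fun p hp ↦ ?_).trans
        (Nat.prod_primeFactors_dvd n)
      rw [Finset.mem_filter, Nat.mem_primesLE] at hp
      exact Nat.mem_primeFactors.2 ⟨hp.1.2, hp.2, hn.1.ne'⟩
    have hpos : ∀ p ∈ N.primesLE.filter (· ∣ n), 0 < p := fun p hp ↦
      (Nat.mem_primesLE.1 (Finset.mem_filter.1 hp).1).2.pos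
    rw [← Real.log_prod fun p hp ↦ by exact_mod_cast (hpos p hp).ne']
    refine Real.log_le_log (Finset.prod_pos fun p hp ↦ by exact_mod_cast hpos p hp) ?_
    rw [← Nat.cast_prod]
    exact Nat.cast_le.2 hsub
  have swap : ∑ p ∈ N.primesLE, ((N / p : ℕ) : ℝ) * Real.log p ≤ N * Real.log N := by
    calc ∑ p ∈ N.primesLE, ((N / p : ℕ) : ℝ) * Real.log p
        = ∑ p ∈ N.primesLE, ∑ n ∈ Finset.Ioc 0 N with p ∣ n, Real.log p := by
          simp [Nat.Ioc_filter_dvd_card_eq_div]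
      _ = ∑ n ∈ Finset.Ioc 0 N, ∑ p ∈ N.primesLE with p ∣ n, Real.log p :=
          Finset.sum_comm' fun p n ↦ by simp only [Finset.mem_filter]; tauto
      _ ≤ ∑ n ∈ Finset.Ioc 0 N, Real.log N := Finset.sum_le_sum log_ge
      _ = N * Real.log N := by simp
  have floor_ge : ∑ p ∈ N.primesLE, (N / p - 1 : ℝ) * Real.log p ≤
      ∑ p ∈ N.primesLE, ((N / p : ℕ) : ℝ) * Real.log p := by
    gcongr with p hp
    have := Nat.lt_floor_add_one ((N : ℝ) / p)
    rw [Nat.floor_div_eq_div] at this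
    linarith
  have theta_le := Chebyshev.theta_le_log4_mul_x hN'.le
  rw [Chebyshev.theta_eq_sum_primesLE_log] at theta_le
  have expand : ∑ p ∈ N.primesLE, (N / p - 1 : ℝ) * Real.log p =
      N * ∑ p ∈ N.primesLE, Real.log p / p - ∑ p ∈ N.primesLE, Real.log p := by
    rw [Finset.mul_sum, ← Finset.sum_sub_distrib]
    exact Finset.sum_congr rfl fun p _ ↦ by ring
  refine le_of_mul_le_mul_left ?_ hN'
  linarith

theorem tsum_nat_rpow_neg_le {s : ℝ} (hs : 1 < s) :
    ∑' n : ℕ, (n : ℝ) ^ (-s) ≤ 1 + 1 / (s - 1) := by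
  have hsum : Summable fun n : ℕ ↦ (n : ℝ) ^ (-s) := Real.summable_nat_rpow.2 (by linarith)
  have shift : ∑' n : ℕ, (n : ℝ) ^ (-s) = ∑' n : ℕ, 1 / (n + 1 : ℝ) ^ s := by
    rw [hsum.tsum_eq_zero_add, Nat.cast_zero, Real.zero_rpow (by linarith), zero_add]
    refine tsum_congr fun n ↦ ?_
    rw [Real.rpow_neg (by positivity), one_div]
    push_cast
    rfl
  have hterm : 0 ≤ ZetaAsymptotics.termTSum s :=
    tsum_nonneg fun n ↦ ZetaAsymptotics.term_nonneg _ _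
  have := ZetaAsymptotics.zeta_limit_aux1 hs
  nlinarith

theorem exp_sum_prime_rpow_neg_le {S : Finset ℕ} (hS : ∀ p ∈ S, p.Prime) {s : ℝ} (hs : 1 < s) :
    Real.exp (∑ p ∈ S, (p : ℝ) ^ (-s)) ≤ 1 + 1 / (s - 1) := by
  let f : ℕ →* ℝ :=
    { toFun := fun n ↦ (n : ℝ) ^ (-s)
      map_one' := by simp
      map_mul' := fun m n ↦ by
        rw [Nat.cast_mul, Real.mul_rpow (Nat.cast_nonneg m) (Nat.cast_nonneg n)] }
  have hsum : Summable f := Real.summable_nat_rpow.2 (by linarith)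
  have hnonneg : ∀ n, 0 ≤ f n := fun n ↦ Real.rpow_nonneg (Nat.cast_nonneg n) _
  have hlt : ∀ p ∈ S, f p < 1 := fun p hp ↦
    lt_of_le_of_lt (Real.le_norm_self _) (hsum.norm_lt_one (hS p hp).one_lt)
  calc Real.exp (∑ p ∈ S, f p) = ∏ p ∈ S, Real.exp (f p) := Real.exp_sum _ _
    _ ≤ ∏ p ∈ S, (1 - f p)⁻¹ := by
        refine Finset.prod_le_prod (fun p _ ↦ (Real.exp_pos _).le) fun p hp ↦ ?_
        rw [← inv_inv (Real.exp (f p)), ← Real.exp_neg]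
        have := Real.add_one_le_exp (-f p)
        exact inv_anti₀ (by linarith [hlt p hp]) (by linarith)
    _ = ∑' m : Nat.factoredNumbers S, f m := by
        rw [← EulerProduct.prod_filter_prime_geometric_eq_tsum_factoredNumbers hsum,
          Finset.filter_true_of_mem hS]
    _ ≤ ∑' n : ℕ, f n := hsum.tsum_subtype_le _ _ hnonneg
    _ ≤ 1 + 1 / (s - 1) := tsum_nat_rpow_neg_le hs

theorem sum_prime_inv_sq_le_one {S : Finset ℕ} (hS : ∀ p ∈ S, p.Prime) :
    ∑ p ∈ S, ((p : ℝ) ^ 2)⁻¹ ≤ 1 := by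
  calc ∑ p ∈ S, ((p : ℝ) ^ 2)⁻¹ ≤ ∑ p ∈ Finset.Ioo 1 (S.sup id + 1), ((p : ℝ) ^ 2)⁻¹ := by
        refine Finset.sum_le_sum_of_subset_of_nonneg (fun p hp ↦ ?_) fun _ _ _ ↦ by positivity
        exact Finset.mem_Ioo.2
          ⟨(hS p hp).one_lt, Nat.lt_succ_of_le (Finset.le_sup (f := id) hp)⟩
    _ ≤ 2 / ((1 : ℕ) + 1) := sum_Ioo_inv_sq_le 1 _
    _ = 1 := by norm_num

theorem inv_sub_rpow_neg_le {p : ℕ} (hp : 0 < p) (δ : ℝ) :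
    (p : ℝ)⁻¹ - (p : ℝ) ^ (-(1 + δ)) ≤ δ * (Real.log p / p) := by
  have hp' : (0 : ℝ) < p := by exact_mod_cast hp
  have hpow : (p : ℝ) ^ (-(1 + δ)) = (p : ℝ)⁻¹ * Real.exp (-(δ * Real.log p)) := by
    rw [neg_add, Real.rpow_add hp', Real.rpow_neg_one, Real.rpow_def_of_pos hp']
    ring_nf
  have hexp := Real.add_one_le_exp (-(δ * Real.log p))
  rw [hpow, show δ * (Real.log p / p) = (p : ℝ)⁻¹ * (δ * Real.log p) by ring]
  have : 0 < (p : ℝ)⁻¹ := by positivity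
  nlinarith

/-- Among sets of at most `N` primes the sum of reciprocals is controlled by the primes up to
`N`, uniformly for the exponent `1 + 1 / log N` in place of `1`. -/
theorem sum_prime_inv_le_sum_rpow_add {S : Finset ℕ} (hS : ∀ p ∈ S, p.Prime) {N : ℕ}
    (hN : 2 ≤ N) (hcard : S.card ≤ N) :
    ∑ p ∈ S, (p : ℝ)⁻¹ ≤ ∑ p ∈ S, (p : ℝ) ^ (-(1 + 1 / Real.log N)) + 4 := by
  have hN' : (2 : ℝ) ≤ N := by exact_mod_cast hN
  have hlog2 : Real.log 2 ≤ Real.log N := Real.log_le_log (by norm_num) hN'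
  have hlog2pos : 0 < Real.log 2 := Real.log_pos (by norm_num)
  have hL : 0 < Real.log N := by linarith
  set δ := 1 / Real.log N with hδ
  have hδpos : 0 < δ := by positivity
  have hlogp : ∀ p : ℕ, 0 ≤ δ * (Real.log p / p) := fun p ↦
    mul_nonneg hδpos.le (div_nonneg (Real.log_natCast_nonneg p) (Nat.cast_nonneg p))
  have termwise : ∀ p ∈ S, (p : ℝ)⁻¹ - (p : ℝ) ^ (-(1 + δ)) ≤
      (if p ≤ N then δ * (Real.log p / p) else 0) + (N : ℝ)⁻¹ := by
    intro p hp
    split_ifs with h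
    · exact (inv_sub_rpow_neg_le (hS p hp).pos δ).trans
        (le_add_of_nonneg_right (by positivity))
    · have : (p : ℝ)⁻¹ ≤ (N : ℝ)⁻¹ :=
        inv_anti₀ (by linarith) (by exact_mod_cast (not_le.1 h).le)
      have : 0 ≤ (p : ℝ) ^ (-(1 + δ)) := Real.rpow_nonneg (Nat.cast_nonneg p) _
      linarith
  have small : ∑ p ∈ S, (if p ≤ N then δ * (Real.log p / p) else 0) ≤ 3 := by
    calc ∑ p ∈ S, (if p ≤ N then δ * (Real.log p / p) else 0)
        = ∑ p ∈ S with p ≤ N, δ * (Real.log p / p) := (Finset.sum_filter _ _).symm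
      _ ≤ ∑ p ∈ N.primesLE, δ * (Real.log p / p) := by
          refine Finset.sum_le_sum_of_subset_of_nonneg (fun p hp ↦ ?_) fun p _ _ ↦ hlogp p
          rw [Finset.mem_filter] at hp
          exact Nat.mem_primesLE.2 ⟨hp.2, hS p hp.1⟩
      _ = δ * ∑ p ∈ N.primesLE, Real.log p / p := (Finset.mul_sum _ _ _).symm
      _ ≤ δ * (Real.log N + Real.log 4) := by
          gcongr
          exact sum_primesLE_log_div_le (by omega)
      _ ≤ δ * (3 * Real.log N) := by
          have : Real.log 4 = 2 * Real.log 2 := by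
            rw [show (4 : ℝ) = 2 ^ 2 by norm_num, Real.log_pow]; norm_num
          gcongr
          linarith
      _ = 3 := by rw [hδ]; field_simp
  have large : ∑ _p ∈ S, (N : ℝ)⁻¹ ≤ 1 := by
    rw [Finset.sum_const, nsmul_eq_mul, ← div_eq_mul_inv, div_le_one (by linarith)]
    exact_mod_cast hcard
  have := Finset.sum_le_sum termwise
  rw [Finset.sum_sub_distrib, Finset.sum_add_distrib] at this
  linarith

theorem div_sub_one_sq_le {x : ℝ} (hx : 2 ≤ x) :
    x / (x - 1) ^ 2 ≤ x⁻¹ + 8 * (x ^ 2)⁻¹ := by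
  have h : x⁻¹ + 8 * (x ^ 2)⁻¹ = (x + 8) / x ^ 2 := by
    field_simp
  rw [h, div_le_div_iff₀ (by nlinarith) (by positivity)]
  nlinarith [mul_nonneg (sub_nonneg.2 hx) (sub_nonneg.2 hx)]

theorem prod_one_add_prime_div_sq_le {S : Finset ℕ} (hS : ∀ p ∈ S, p.Prime) {N : ℕ}
    (hN : 2 ≤ N) (hcard : S.card ≤ N) :
    ∏ p ∈ S, (1 + (p : ℝ) / ((p : ℝ) - 1) ^ 2) ≤ Real.exp 12 * (1 + Real.log N) := by
  have hL : 0 < Real.log N := Real.log_pos (by exact_mod_cast hN)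
  have hexponent : ∑ p ∈ S, (p : ℝ) / ((p : ℝ) - 1) ^ 2 ≤
      12 + ∑ p ∈ S, (p : ℝ) ^ (-(1 + 1 / Real.log N)) := by
    have h := Finset.sum_le_sum fun (p : ℕ) (hp : p ∈ S) ↦
      div_sub_one_sq_le (x := (p : ℝ)) (by exact_mod_cast (hS p hp).two_le)
    rw [Finset.sum_add_distrib, ← Finset.mul_sum] at h
    linarith [sum_prime_inv_le_sum_rpow_add hS hN hcard, sum_prime_inv_sq_le_one hS]
  have hs : 1 < 1 + 1 / Real.log N := by
    have : 0 < 1 / Real.log N := by positivity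
    linarith
  calc ∏ p ∈ S, (1 + (p : ℝ) / ((p : ℝ) - 1) ^ 2)
      ≤ ∏ p ∈ S, Real.exp ((p : ℝ) / ((p : ℝ) - 1) ^ 2) := by
        refine Finset.prod_le_prod (fun p _ ↦ by positivity) fun p _ ↦ ?_
        rw [add_comm]
        exact Real.add_one_le_exp _
    _ = Real.exp (∑ p ∈ S, (p : ℝ) / ((p : ℝ) - 1) ^ 2) := (Real.exp_sum _ _).symm
    _ ≤ Real.exp (12 + ∑ p ∈ S, (p : ℝ) ^ (-(1 + 1 / Real.log N))) := Real.exp_le_exp.2 hexponent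
    _ = Real.exp 12 * Real.exp (∑ p ∈ S, (p : ℝ) ^ (-(1 + 1 / Real.log N))) := Real.exp_add _ _
    _ ≤ Real.exp 12 * (1 + Real.log N) := by
        gcongr
        simpa using exp_sum_prime_rpow_neg_le hS hs

theorem div_totient_sq_eq_prod {q : ℕ} (hq : Squarefree q) :
    (q : ℝ) / (Nat.totient q : ℝ) ^ 2 =
      ∏ p ∈ q.primeFactors, ((p : ℝ) / ((p : ℝ) - 1) ^ 2) := by
  have hprod := Nat.prod_primeFactors_of_squarefree hq
  have htot : q.totient = ∏ p ∈ q.primeFactors, (p - 1) := by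
    rw [Nat.totient_eq_div_primeFactors_mul, hprod, Nat.div_self hq.ne_zero.bot_lt, one_mul]
  have htot' : (q.totient : ℝ) = ∏ p ∈ q.primeFactors, ((p : ℝ) - 1) := by
    rw [htot, Nat.cast_prod]
    exact Finset.prod_congr rfl fun p hp ↦ Nat.cast_pred (Nat.prime_of_mem_primeFactors hp).pos
  rw [Finset.prod_div_distrib, Finset.prod_pow, ← htot', ← Nat.cast_prod, hprod]

theorem sum_squarefree_div_totient_sq_le_prod {T S : Finset ℕ} (hT : ∀ q ∈ T, Squarefree q)
    (hTS : ∀ q ∈ T, q.primeFactors ⊆ S) :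
    ∑ q ∈ T, (q : ℝ) / (Nat.totient q : ℝ) ^ 2 ≤
      ∏ p ∈ S, (1 + (p : ℝ) / ((p : ℝ) - 1) ^ 2) := by
  have hinj : Set.InjOn Nat.primeFactors T := fun a ha b hb hab ↦ by
    rw [← Nat.prod_primeFactors_of_squarefree (hT a ha), hab,
      Nat.prod_primeFactors_of_squarefree (hT b hb)]
  rw [Finset.prod_one_add, Finset.sum_congr rfl fun q hq ↦ div_totient_sq_eq_prod (hT q hq),
    ← Finset.sum_image (f := fun t : Finset ℕ ↦ ∏ p ∈ t, ((p : ℝ) / ((p : ℝ) - 1) ^ 2)) hinj]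
  refine Finset.sum_le_sum_of_subset_of_nonneg ?_ fun t _ _ ↦
    Finset.prod_nonneg fun p _ ↦ by positivity
  intro t ht
  obtain ⟨q, hq, rfl⟩ := Finset.mem_image.1 ht
  exact Finset.mem_powerset.2 (hTS q hq)

theorem orderOf_two_pos {q : ℕ} (hq : Odd q) : 0 < orderOf (2 : ZMod q) := by
  have : NeZero q := ⟨hq.pos.ne'⟩
  have hunit : ((ZMod.unitOfCoprime 2 (Nat.coprime_two_left.2 hq) : (ZMod q)ˣ) : ZMod q) = 2 := by
    simp
  rw [← hunit, orderOf_units]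
  exact orderOf_pos _

theorem dvd_two_pow_orderOf_sub_one (q : ℕ) : q ∣ 2 ^ orderOf (2 : ZMod q) - 1 := by
  rw [← ZMod.natCast_eq_zero_iff, Nat.cast_sub Nat.one_le_two_pow]
  simp [pow_orderOf_eq_one]

theorem prod_two_pow_sub_one_pos (X : ℕ) : 0 < ∏ e ∈ Finset.Icc 1 X, (2 ^ e - 1) :=
  Finset.prod_pos fun e he ↦
    Nat.sub_pos_of_lt (Nat.one_lt_two_pow (by have := (Finset.mem_Icc.1 he).1; omega))

theorem dvd_prod_two_pow_sub_one {q X : ℕ} (hq : Odd q) (hX : orderOf (2 : ZMod q) ≤ X) :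
    q ∣ ∏ e ∈ Finset.Icc 1 X, (2 ^ e - 1) :=
  (dvd_two_pow_orderOf_sub_one q).trans
    (Finset.dvd_prod_of_mem (fun e ↦ 2 ^ e - 1) (Finset.mem_Icc.2 ⟨orderOf_two_pos hq, hX⟩))

theorem card_primeFactors_prod_two_pow_sub_one_le (X : ℕ) :
    (∏ e ∈ Finset.Icc 1 X, (2 ^ e - 1)).primeFactors.card ≤ X ^ 2 := by
  set P := ∏ e ∈ Finset.Icc 1 X, (2 ^ e - 1)
  refine (Nat.pow_le_pow_iff_right (a := 2) (by norm_num)).1 ?_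
  calc 2 ^ P.primeFactors.card ≤ ∏ p ∈ P.primeFactors, p :=
        Finset.pow_card_le_prod _ _ _ fun p hp ↦ (Nat.prime_of_mem_primeFactors hp).two_le
    _ ≤ P := Nat.le_of_dvd (prod_two_pow_sub_one_pos X) (Nat.prod_primeFactors_dvd P)
    _ ≤ (2 ^ X) ^ (Finset.Icc 1 X).card :=
        Finset.prod_le_pow_card _ _ _ fun e he ↦ (Nat.sub_le _ _).trans
          (Nat.pow_le_pow_right (by norm_num) (Finset.mem_Icc.1 he).2)
    _ = 2 ^ X ^ 2 := by rw [Nat.card_Icc, ← pow_mul, Nat.add_sub_cancel, sq]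


open Classical in
/-- **Gallagher's lemma** (Lemma 6 of the paper): `∑_{ε(q) ≤ x} μ²(q) q / φ(q)² ≪ log x`,
where the sum is over odd squarefree `q` whose multiplicative order `ε(q)` of `2` mod `q`
is at most `x`. -/
theorem sum_over_small_order_le_log :
    ∃ C : ℝ, 0 < C ∧ ∀ x : ℝ, 2 ≤ x →
      (∑ᶠ q : ℕ, if Odd q ∧ Squarefree q ∧ (orderOf (2 : ZMod q) : ℝ) ≤ x then
          (q : ℝ) / (Nat.totient q : ℝ) ^ 2 else 0) ≤ C * Real.log x := by
  refine ⟨4 * Real.exp 12, by positivity, fun x hx ↦ ?_⟩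
  set X := ⌊x⌋₊ with hXdef
  have hX : 2 ≤ X := Nat.le_floor (by exact_mod_cast hx)
  set P := ∏ e ∈ Finset.Icc 1 X, (2 ^ e - 1)
  have hP : P ≠ 0 := (prod_two_pow_sub_one_pos X).ne'
  have hdvd : ∀ q : ℕ, Odd q ∧ Squarefree q ∧ (orderOf (2 : ZMod q) : ℝ) ≤ x → q ∣ P :=
    fun q hq ↦ dvd_prod_two_pow_sub_one hq.1 (Nat.le_floor hq.2.2)
  rw [finsum_eq_sum_of_support_subset (s := P.divisors), ← Finset.sum_filter]
  · have hsum := sum_squarefree_div_totient_sq_le_prod (S := P.primeFactors)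
      (T := P.divisors.filter
        fun q : ℕ ↦ Odd q ∧ Squarefree q ∧ (orderOf (2 : ZMod q) : ℝ) ≤ x)
      (fun q hq ↦ (Finset.mem_filter.1 hq).2.2.1)
      (fun q hq ↦ Nat.primeFactors_mono (hdvd q (Finset.mem_filter.1 hq).2) hP)
    have hprod := prod_one_add_prime_div_sq_le (S := P.primeFactors) (N := X ^ 2)
      (fun p hp ↦ Nat.prime_of_mem_primeFactors hp) (by nlinarith)
      (card_primeFactors_prod_two_pow_sub_one_le X)
    have hlogX : Real.log ((X ^ 2 : ℕ) : ℝ) ≤ 2 * Real.log x := by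
      rw [Nat.cast_pow, Real.log_pow, Nat.cast_ofNat]
      gcongr
      exact Nat.floor_le (by linarith)
    have hlogx : 1 / 2 ≤ Real.log x := by
      have := Real.log_le_log (by norm_num) hx
      linarith [Real.log_two_gt_d9]
    calc _ ≤ Real.exp 12 * (1 + Real.log ((X ^ 2 : ℕ) : ℝ)) := hsum.trans hprod
      _ ≤ Real.exp 12 * (4 * Real.log x) := by
        gcongr
        linarith
      _ = 4 * Real.exp 12 * Real.log x := by ring
  · intro q hq
    have hq' : Odd q ∧ Squarefree q ∧ (orderOf (2 : ZMod q) : ℝ) ≤ x := by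
      by_contra h
      exact hq (if_neg h)
    exact Finset.mem_coe.2 (Nat.mem_divisors.2 ⟨hdvd q hq', hP⟩)
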